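/- arXiv:1402.4489 — 3 statements merged into one kernel-verified Lean document; each statement's English description precedes it below -/
import Mathlib

section
/- Let d ≥ 3, σ ≥ 0, n > σ with n − σ > (3/4)·d·2^d − 2d, and set ξ := (5 − 2^{4−d})/(3 − 2^{3−d}). Then there exist δ > 0 and C > 0, depending only on d and n, such that for all P ≥ 2, all q ∈ ℕ with q ≤ P^ξ, and all α ∈ 𝕋 with ‖qα‖ ≤ P^{−ξ}: M(α, q)^{n−σ} ≤ C·(P^{−d−δ} + η_q^{−(n−σ)}). -/
noncomputable section
open scoped Classical
open MvPolynomial MeasureTheory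

/-- Distance from a real number to the nearest integer. -/
def nint (x : ℝ) : ℝ := |x - round x|

/-- `α ∈ 𝕋` and `q ∈ ℕ` are *primitive* if there is `a` coprime to `q`
with `‖qα‖ = |qα - a|`. -/
def Primitive (α : ℝ) (q : ℕ) : Prop :=
  ∃ a : ℤ, Int.gcd a q = 1 ∧ nint (q * α) = |q * α - a|

/-- `e(t) = exp(2πit)`. -/
def eC (t : ℝ) : ℂ := Complex.exp (2 * Real.pi * Complex.I * t)

/-- The exponential sum `S(α, P) = Σ_{x ∈ ℤⁿ} ω(x/P) e(α f(x))`. -/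
def expSum (n : ℕ) (f : MvPolynomial (Fin n) ℤ) (ω : (Fin n → ℝ) → ℝ) (α P : ℝ) : ℂ :=
  ∑' x : Fin n → ℤ, (ω (fun i => (x i : ℝ) / P) : ℂ) * eC (α * (MvPolynomial.eval x f : ℝ))

/-- Mixed partial derivative `∂^ε g`. -/
def mpderiv (n : ℕ) (ε : Fin n → ℕ) (g : (Fin n → ℝ) → ℝ) : (Fin n → ℝ) → ℝ :=
  (List.finRange n).foldr
    (fun i h => (fun u : (Fin n → ℝ) → ℝ => fun x => fderiv ℝ u x (Pi.single i 1))^[ε i] h) g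

/-- A super-exponential increasing tuple of positive constants `(c, c₀, c₁, …)`. -/
def SuperSeq (c : ℝ) (cs : ℕ → ℝ) : Prop :=
  0 < c ∧ c ≤ cs 0 ∧ Monotone cs ∧ ∀ i j, cs i * cs j ≤ cs (i + j)

/-- Membership of `ω` in the class `𝒮⁺(𝐜)` of smooth weight functions. -/
def SmoothWeight (n : ℕ) (c : ℝ) (cs : ℕ → ℝ) (ω : (Fin n → ℝ) → ℝ) : Prop :=
  ContDiff ℝ (⊤ : ℕ∞) ω ∧ (∀ x, 0 ≤ ω x) ∧ (∀ x, ω x ≠ 0 → ∀ i, |x i| ≤ c) ∧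
    ∀ (ε : Fin n → ℕ) (x : Fin n → ℝ), |mpderiv n ε ω x| ≤ cs (∑ i, ε i)

/-- Dimension of the singular locus of `g` over `K`, i.e. the Krull dimension
of the coordinate ring of the affine set cut out by `∇g = 0`. -/
def singDim (n : ℕ) (K : Type) [CommRing K] (g : MvPolynomial (Fin n) K) : WithBot (WithTop ℕ) :=
  ringKrullDim (MvPolynomial (Fin n) K ⧸ Ideal.span (Set.range fun i => MvPolynomial.pderiv i g))

/-- `Height f ≤ H`: all coefficients of `f` are at most `H` in absolute value. -/
def HeightLe (n : ℕ) (f : MvPolynomial (Fin n) ℤ) (H : ℝ) : Prop :=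
  ∀ m : Fin n →₀ ℕ, |((f.coeff m : ℤ) : ℝ)| ≤ H

/-- `Height_{P,k} f ≤ H`: the relative height of `f` w.r.t. `P` at scale `k` is at most `H`. -/
def HeightPLe (n k : ℕ) (P : ℝ) (f : MvPolynomial (Fin n) ℤ) (H : ℝ) : Prop :=
  ∀ m : Fin n →₀ ℕ, |((f.coeff m : ℤ) : ℝ)| * P ^ (m.sum fun _ e => e) ≤ H * P ^ k

/-- `b = ∏_{p^e ∥ q, e ≤ 2} p^e`. -/
def bOf (q : ℕ) : ℕ :=
  ∏ p ∈ q.primeFactors, if q.factorization p ≤ 2 then p ^ q.factorization p else 1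

/-- `c₁ = ∏_{p^e ∥ q, e > 2} p^⌊e/2⌋`. -/
def c1Of (q : ℕ) : ℕ :=
  ∏ p ∈ q.primeFactors, if 2 < q.factorization p then p ^ (q.factorization p / 2) else 1

/-- `c₂ = ∏_{p^e ∥ q, e > 2, e odd} p`. -/
def c2Of (q : ℕ) : ℕ :=
  ∏ p ∈ q.primeFactors, if 2 < q.factorization p ∧ Odd (q.factorization p) then p else 1

/-- `η_q = max{(b³c₁c₂²)^{1/(2^d−2)}, (b³c₁²c₂)^{1/(5·2^{d−2}−4)}}`. -/
def etaOf (d q : ℕ) : ℝ :=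
  max (((bOf q : ℝ) ^ 3 * (c1Of q : ℝ) * (c2Of q : ℝ) ^ 2) ^ ((1 : ℝ) / ((2:ℝ) ^ (d : ℝ) - 2)))
      (((bOf q : ℝ) ^ 3 * (c1Of q : ℝ) ^ 2 * (c2Of q : ℝ)) ^
        ((1 : ℝ) / (5 * (2:ℝ) ^ ((d : ℝ) - 2) - 4)))

/-- The `r`-values `r_i = ∏_{p^e ∥ kb, σ_p(g^{[k]}) = i} p^e` of `g` w.r.t. `q`. -/
def rOf (n k q : ℕ) (g : MvPolynomial (Fin n) ℤ) (i : ℕ) : ℕ :=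
  ∏ p ∈ (k * bOf q).primeFactors,
    if singDim n (ZMod p)
        (MvPolynomial.map (Int.castRingHom (ZMod p)) (MvPolynomial.homogeneousComponent k g))
        = (i : WithBot (WithTop ℕ))
    then p ^ ((k * bOf q).factorization p) else 1

/-- `R^{[k]}_ζ(g, q) = ∏_{ζ ≤ i ≤ n} r_i^{i−ζ}`. -/
def ROf (n k q : ℕ) (g : MvPolynomial (Fin n) ℤ) (ζ : ℕ) : ℕ :=
  ∏ i ∈ Finset.Icc ζ n, (rOf n k q g i) ^ (i - ζ)

/-- `ξ = (5 − 2^{4−d})/(3 − 2^{3−d})`. -/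
def xiOf (d : ℕ) : ℝ := (5 - (2:ℝ) ^ ((4 : ℝ) - d)) / (3 - (2:ℝ) ^ ((3 : ℝ) - d))

/-- `γ = 1/(3·2^{d−2} − 2)`. -/
def gamOf (d : ℕ) : ℝ := 1 / (3 * (2:ℝ) ^ ((d : ℝ) - 2) - 2)

/-- `A_d = 7·2^{d−4} − 5/4`. -/
def AdOf (d : ℕ) : ℝ := 7 * (2:ℝ) ^ ((d : ℝ) - 4) - 5 / 4

/-- `B_k = (k−1)·2^{d−1}`. -/
def BkOf (d k : ℕ) : ℝ := ((k : ℝ) - 1) * (2:ℝ) ^ ((d : ℝ) - 1)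

/-- `V_k = 2^{d+1−k} − 2`. -/
def VkOf (d k : ℕ) : ℝ := (2:ℝ) ^ ((d : ℝ) + 1 - (k : ℝ)) - 2

/-- `C(α, q) = (‖qα‖P)^{1/(2^{d−1}−2)} + (qP^{−2})^{1/2^{d−2}} + η_q⁻¹`. -/
def CCof (d : ℕ) (P : ℝ) (q : ℕ) (α : ℝ) : ℝ :=
  (nint (q * α) * P) ^ (1 / ((2:ℝ) ^ ((d : ℝ) - 1) - 2)) +
    ((q : ℝ) * P ^ (-(2 : ℝ))) ^ (1 / (2:ℝ) ^ ((d : ℝ) - 2)) + (etaOf d q)⁻¹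

/-- `W_k(α, q)`; the term `(‖qα‖P^k)^{−1/B_k}` is interpreted as `+∞` when `‖qα‖ = 0`. -/
def WWof (d k : ℕ) (P : ℝ) (q : ℕ) (α : ℝ) : ℝ :=
  P ^ (-((2:ℝ) ^ (1 - (d : ℝ)))) + nint (q * α) ^ (1 / (BkOf d k + VkOf d k)) +
    ((q : ℝ) * P ^ (-(k : ℝ))) ^ (1 / BkOf d k) +
    min ((q : ℝ) ^ (-(1 / (BkOf d k + VkOf d k))))
      (if nint (q * α) = 0 then (q : ℝ) ^ (-(1 / (BkOf d k + VkOf d k)))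
       else (nint (q * α) * P ^ (k : ℝ)) ^ (-(1 / BkOf d k)))

/-- `M(α, q) = min{C(α, q), W₃(α, q), …, W_d(α, q)}`. -/
def MMof (d : ℕ) (P : ℝ) (q : ℕ) (α : ℝ) : ℝ :=
  min (CCof d P q α) (sInf ((fun k => WWof d k P q α) '' Set.Icc 3 d))

/-- `W_k*(α, q)`; the term `(‖qα‖P^k)^{−1/B_k}` is interpreted as `+∞` when `‖qα‖ = 0`. -/
def WSof (d k : ℕ) (P : ℝ) (q : ℕ) (α : ℝ) : ℝ :=
  max (nint (q * α) ^ (1 / (BkOf d k + VkOf d k)))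
    (min ((etaOf d q)⁻¹)
      (if nint (q * α) = 0 then (etaOf d q)⁻¹
       else (nint (q * α) * P ^ (k : ℝ)) ^ (-(1 / BkOf d k))))

/-- `M*(α, q) = min{W₃*(α, q), …, W_d*(α, q)}`. -/
def MSof (d : ℕ) (P : ℝ) (q : ℕ) (α : ℝ) : ℝ :=
  sInf ((fun k => WSof d k P q α) '' Set.Icc 3 d)

/-- The major arcs `𝔐(Δ)`, viewed inside a fundamental domain `[0,1)` for `𝕋 = ℝ/ℤ`. -/
def majorArcs (d : ℕ) (Δ P : ℝ) : Set ℝ :=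
  {α | ∃ q : ℕ, 0 < q ∧ (q : ℝ) ≤ P ^ Δ ∧
    ∃ a : ℕ, a ≤ q ∧ Nat.gcd a q = 1 ∧ nint (α - (a : ℝ) / q) ≤ P ^ (Δ - d)}

/-- The minor arcs `𝔪 = 𝕋 ∖ 𝔐(Δ)`. -/
def minorArcs (d : ℕ) (Δ P : ℝ) : Set ℝ := Set.Ico (0 : ℝ) 1 \ majorArcs d Δ P



lemma nint_nonneg (x : ℝ) : 0 ≤ nint x := abs_nonneg _

lemma etaOf_nonneg (d q : ℕ) : 0 ≤ etaOf d q :=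
  le_max_of_le_left (by positivity)

lemma WWof_nonneg (d k : ℕ) {P : ℝ} (hP : 0 < P) (q : ℕ) (α : ℝ) : 0 ≤ WWof d k P q α := by
  have h := nint_nonneg (q * α)
  unfold WWof
  have : 0 ≤ min ((q : ℝ) ^ (-(1 / (BkOf d k + VkOf d k))))
      (if nint (q * α) = 0 then (q : ℝ) ^ (-(1 / (BkOf d k + VkOf d k)))
       else (nint (q * α) * P ^ (k : ℝ)) ^ (-(1 / BkOf d k))) := by
    refine le_min (by positivity) ?_
    split_ifs <;> positivity
  positivity

lemma MMof_nonneg (d : ℕ) {P : ℝ} (hP : 0 < P) (q : ℕ) (α : ℝ) : 0 ≤ MMof d P q α := by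
  refine le_min ?_ (Real.sInf_nonneg ?_)
  · have h := nint_nonneg (q * α)
    have h' := etaOf_nonneg d q
    unfold CCof
    positivity
  · rintro _ ⟨k, -, rfl⟩
    exact WWof_nonneg d k hP q α

lemma two_le_two_rpow_sub_two {d : ℕ} (hd : 3 ≤ d) : 2 ≤ (2 : ℝ) ^ ((d : ℝ) - 2) := by
  have hd' : (3 : ℝ) ≤ d := by exact_mod_cast hd
  calc (2 : ℝ) = 2 ^ (1 : ℝ) := (Real.rpow_one 2).symm
    _ ≤ _ := Real.rpow_le_rpow_of_exponent_le (by norm_num) (by linarith)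

lemma two_rpow_sub_one (d : ℕ) : (2 : ℝ) ^ ((d : ℝ) - 1) = 2 * 2 ^ ((d : ℝ) - 2) := by
  rw [show (d : ℝ) - 1 = 1 + (d - 2) by ring, Real.rpow_add (by norm_num), Real.rpow_one]

lemma xiOf_eq {d : ℕ} (hd : 3 ≤ d) :
    xiOf d = (5 * (2 : ℝ) ^ ((d : ℝ) - 2) - 4) * gamOf d := by
  have h := two_le_two_rpow_sub_two hd
  have h4 : (2 : ℝ) ^ ((4 : ℝ) - d) = 4 / 2 ^ ((d : ℝ) - 2) := by
    rw [show (4 : ℝ) - d = (2 : ℕ) - (d - 2) by push_cast; ring, Real.rpow_sub (by norm_num),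
      Real.rpow_natCast]
    norm_num
  have h3 : (2 : ℝ) ^ ((3 : ℝ) - d) = 2 / 2 ^ ((d : ℝ) - 2) := by
    rw [show (3 : ℝ) - d = 1 - (d - 2) by ring, Real.rpow_sub (by norm_num), Real.rpow_one]
  unfold xiOf gamOf
  rw [h4, h3]
  generalize (2 : ℝ) ^ ((d : ℝ) - 2) = D at h
  have h0 : D ≠ 0 := by linarith
  have h1 : 3 * D - 2 ≠ 0 := by linarith
  have h2 : 3 - 2 / D ≠ 0 := by
    rw [show 3 - 2 / D = (3 * D - 2) / D by field_simp]
    exact div_ne_zero h1 h0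
  field_simp

lemma CCof_le {d : ℕ} (hd : 3 ≤ d) {P : ℝ} (hP : 0 < P) {q : ℕ}
    (hq : (q : ℝ) ≤ P ^ xiOf d) {α : ℝ} (hα : nint (q * α) ≤ P ^ (-(xiOf d))) :
    CCof d P q α ≤ 2 * P ^ (-gamOf d) + (etaOf d q)⁻¹ := by
  have hn := nint_nonneg (q * α)
  have h := two_le_two_rpow_sub_two hd
  have hξ := xiOf_eq hd
  unfold CCof
  rw [two_rpow_sub_one]
  have hγ : gamOf d * (3 * (2 : ℝ) ^ ((d : ℝ) - 2) - 2) = 1 :=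
    one_div_mul_cancel (by linarith)
  generalize (2 : ℝ) ^ ((d : ℝ) - 2) = D at h hξ hγ
  have hD : 2 * D - 2 ≠ 0 := by linarith
  have hD0 : D ≠ 0 := by linarith
  have h1 : (nint (q * α) * P) ^ (1 / (2 * D - 2)) ≤ P ^ (-gamOf d) := by
    calc _ ≤ (P ^ (-(xiOf d)) * P) ^ (1 / (2 * D - 2)) := by
          refine Real.rpow_le_rpow (by positivity) (by gcongr) ?_
          exact one_div_nonneg.2 (by linarith)
      _ = _ := by
          rw [← Real.rpow_add_one hP.ne', ← Real.rpow_mul hP.le, hξ]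
          congr 1
          rw [mul_one_div, div_eq_iff hD]
          linear_combination -hγ
  have h2 : ((q : ℝ) * P ^ (-(2 : ℝ))) ^ (1 / D) ≤ P ^ (-gamOf d) := by
    calc _ ≤ (P ^ (xiOf d) * P ^ (-(2 : ℝ))) ^ (1 / D) := by
          refine Real.rpow_le_rpow (by positivity) (by gcongr) ?_
          exact one_div_nonneg.2 (by linarith)
      _ = _ := by
          rw [← Real.rpow_add hP, ← Real.rpow_mul hP.le, hξ]
          congr 1
          rw [mul_one_div, div_eq_iff hD0]
          linear_combination 2 * hγ
  linarith

lemma two_mul_add_rpow_le {x y s : ℝ} (hx : 0 ≤ x) (hy : 0 ≤ y) (hs : 0 ≤ s) :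
    (2 * x + y) ^ s ≤ 3 ^ s * (x ^ s + y ^ s) := by
  have hm : 0 ≤ max x y := le_max_of_le_left hx
  calc (2 * x + y) ^ s ≤ (3 * max x y) ^ s :=
        Real.rpow_le_rpow (by positivity)
          (by linarith [le_max_left x y, le_max_right x y]) hs
    _ = 3 ^ s * max x y ^ s := Real.mul_rpow (by norm_num) hm
    _ ≤ 3 ^ s * (x ^ s + y ^ s) := by
        have hxs := Real.rpow_nonneg hx s
        have hys := Real.rpow_nonneg hy s
        refine mul_le_mul_of_nonneg_left ?_ (by positivity)
        rcases max_choice x y with h | h <;> rw [h] <;> linarith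

/-- The pointwise bound `M(α, q)^{n−σ} ≪ P^{−d−δ} + η_q^{−(n−σ)}`. -/
theorem M_eta_bound (d n σ : ℕ) (hd : 3 ≤ d) (hσ : σ < n)
    (hn : (3 : ℝ) / 4 * d * 2 ^ d - 2 * d < (n : ℝ) - (σ : ℝ)) :
    ∃ δ C : ℝ, 0 < δ ∧ 0 < C ∧
      ∀ P : ℝ, 2 ≤ P →
      ∀ q : ℕ, 0 < q → (q : ℝ) ≤ P ^ xiOf d →
      ∀ α : ℝ, nint (q * α) ≤ P ^ (-(xiOf d)) →
        (MMof d P q α) ^ ((n : ℝ) - σ) ≤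
          C * (P ^ (-(d : ℝ) - δ) + (etaOf d q) ^ (-((n : ℝ) - σ))) := by
  have hs : (0 : ℝ) < n - σ := sub_pos.2 (by exact_mod_cast hσ)
  have hD := two_le_two_rpow_sub_two hd
  have hD4 : (2 : ℝ) ^ ((d : ℝ) - 2) = 2 ^ d / 4 := by
    rw [show (d : ℝ) - 2 = d - (2 : ℕ) by norm_num, Real.rpow_sub (by norm_num),
      Real.rpow_natCast, Real.rpow_natCast]
    norm_num
  refine ⟨gamOf d * (n - σ) - d, 3 ^ ((n : ℝ) - σ), ?_, by positivity, ?_⟩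
  · rw [gamOf, one_div_mul_eq_div, sub_pos, lt_div_iff₀ (by linarith), hD4]
    linarith
  · intro P hP q _ hqP α hα
    have hP0 : 0 < P := by linarith
    have hη := etaOf_nonneg d q
    calc MMof d P q α ^ ((n : ℝ) - σ)
        ≤ (2 * P ^ (-gamOf d) + (etaOf d q)⁻¹) ^ ((n : ℝ) - σ) :=
          Real.rpow_le_rpow (MMof_nonneg d hP0 q α)
            ((min_le_left _ _).trans (CCof_le hd hP0 hqP hα)) hs.le
      _ ≤ 3 ^ ((n : ℝ) - σ) *
            ((P ^ (-gamOf d)) ^ ((n : ℝ) - σ) + (etaOf d q)⁻¹ ^ ((n : ℝ) - σ)) :=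
          two_mul_add_rpow_le (by positivity) (by positivity) hs.le
      _ = _ := by
          rw [← Real.rpow_mul hP0.le, Real.inv_rpow hη, ← Real.rpow_neg hη]
          ring_nf
end
end

section
/- Let d ≥ 3 and set A_d := 7·2^{d−4} − 5/4. Then there is a constant C > 0 (depending only on d) such that for every real R ≥ 1: #{q ∈ ℕ : η_q ≤ R} ≤ C·R^{A_d}. -/
noncomputable section
open scoped Classical
open MvPolynomial MeasureTheory

/-- Partial sums of a nonnegative multiplicative function are bounded as soon as the local
factors of its Euler product are `1 + u p` with `u` summable. -/
theorem sum_le_exp_tsum_of_local_factor_le {f u : ℕ → ℝ} (hf₁ : f 1 = 1)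
    (hmul : ∀ {m n : ℕ}, Nat.Coprime m n → f (m * n) = f m * f n) (hf₀ : ∀ n, 0 ≤ f n)
    (hsum : ∀ {p : ℕ}, p.Prime → Summable fun e : ℕ => f (p ^ e))
    (hu : Summable u) (hu₀ : ∀ n, 0 ≤ u n)
    (hlocal : ∀ {p : ℕ}, p.Prime → ∑' e : ℕ, f (p ^ e) ≤ 1 + u p)
    (T : Finset ℕ) (hT : ∀ q ∈ T, q ≠ 0) : ∑ q ∈ T, f q ≤ Real.exp (∑' n, u n) := by
  have hnorm : ∀ {p : ℕ}, p.Prime → Summable fun e : ℕ => ‖f (p ^ e)‖ := fun hp =>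
    (hsum hp).norm
  set s := T.biUnion Nat.primeFactors with hs
  obtain ⟨-, hprod⟩ :=
    EulerProduct.summable_and_hasSum_factoredNumbers_prod_filter_prime_tsum hf₁ hmul hnorm s
  have hmem : ∀ q ∈ T, q ∈ Nat.factoredNumbers s := fun q hq =>
    Nat.mem_factoredNumbers_of_primeFactors_subset (hT q hq)
      (Finset.subset_biUnion_of_mem Nat.primeFactors hq)
  have hle : ∑ q ∈ T, f q ≤ ∏ p ∈ s with p.Prime, ∑' e : ℕ, f (p ^ e) := by
    rw [← Finset.sum_subtype_of_mem f hmem]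
    exact sum_le_hasSum _ (fun q _ => hf₀ q) hprod
  refine hle.trans ?_
  calc ∏ p ∈ s with p.Prime, ∑' e : ℕ, f (p ^ e)
      ≤ ∏ p ∈ s with p.Prime, (1 + u p) :=
        Finset.prod_le_prod (fun p _ => tsum_nonneg fun e => hf₀ _)
          fun p hp => hlocal (Finset.mem_filter.mp hp).2
    _ ≤ Real.exp (∑ p ∈ s with p.Prime, u p) :=
        Real.prod_one_add_le_exp_sum _ hu₀
    _ ≤ Real.exp (∑' n, u n) :=
        Real.exp_le_exp.mpr (hu.sum_le_tsum _ fun n _ => hu₀ n)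

/-- The exponent of `p` in `b⁶c₁³c₂³` when `p^e ∥ q`. -/
def etaExp (e : ℕ) : ℕ := if e ≤ 2 then 6 * e else 3 * ((e + 1) / 2)

theorem le_etaExp {e : ℕ} (he : e ≠ 0) : 6 + (e - 4) ≤ etaExp e := by
  unfold etaExp
  split_ifs <;> omega

/-- The multiplicative function `b⁶c₁³c₂³` of `q`. -/
def etaProd (q : ℕ) : ℕ := q.factorization.prod fun p e => p ^ etaExp e

theorem etaProd_eq (q : ℕ) : bOf q ^ 6 * c1Of q ^ 3 * c2Of q ^ 3 = etaProd q := by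
  unfold bOf c1Of c2Of etaProd Finsupp.prod
  rw [Nat.support_factorization, ← Finset.prod_pow, ← Finset.prod_pow, ← Finset.prod_pow,
    ← Finset.prod_mul_distrib, ← Finset.prod_mul_distrib]
  refine Finset.prod_congr rfl fun p _ => ?_
  unfold etaExp
  rcases le_or_gt (q.factorization p) 2 with h | h
  · simp [h, h.not_gt, ← pow_mul, mul_comm]
  · rcases Nat.even_or_odd (q.factorization p) with hp | hp
    · have : (q.factorization p + 1) / 2 = q.factorization p / 2 := by
        obtain ⟨k, hk⟩ := hp
        omega
      simp [h, h.not_ge, Nat.not_odd_iff_even.mpr hp, this, ← pow_mul, mul_comm]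
    · have : (q.factorization p + 1) / 2 = q.factorization p / 2 + 1 := by
        obtain ⟨k, hk⟩ := hp
        omega
      simp only [h, h.not_ge, hp, this, if_true, if_false, and_self]
      ring

theorem etaProd_one : etaProd 1 = 1 := by simp [etaProd]

theorem etaProd_mul {m n : ℕ} (h : Nat.Coprime m n) :
    etaProd (m * n) = etaProd m * etaProd n := by
  unfold etaProd
  rw [Nat.factorization_mul_of_coprime h, Finsupp.prod_add_index_of_disjoint]
  simpa using h.disjoint_primeFactors

theorem etaProd_prime_pow {p : ℕ} (hp : p.Prime) (e : ℕ) : etaProd (p ^ e) = p ^ etaExp e := by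
  unfold etaProd
  rw [hp.factorization_pow, Finsupp.prod_single_index]
  simp [etaExp]

theorem etaProd_pos {q : ℕ} : 0 < etaProd q := by
  unfold etaProd Finsupp.prod
  rw [Nat.support_factorization]
  exact Finset.prod_pos fun p hp => pow_pos (Nat.pos_of_mem_primeFactors hp) _

theorem etaProd_prime_pow_rpow_le {p : ℕ} (hp : p.Prime) {e : ℕ} (he : e ≠ 0) :
    (etaProd (p ^ e) : ℝ) ^ (-(3 / 16) : ℝ) ≤
      (p : ℝ) ^ (-(9 / 8) : ℝ) * ((2 : ℝ) ^ (-(3 / 16) : ℝ)) ^ (e - 4) := by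
  have hp0 : (0 : ℝ) < p := by exact_mod_cast hp.pos
  have hp2 : (2 : ℝ) ≤ p := by exact_mod_cast hp.two_le
  have hle : (p : ℝ) ^ 6 * 2 ^ (e - 4) ≤ etaProd (p ^ e) := by
    rw [etaProd_prime_pow hp]
    push_cast
    calc (p : ℝ) ^ 6 * 2 ^ (e - 4) ≤ (p : ℝ) ^ 6 * (p : ℝ) ^ (e - 4) := by gcongr
      _ = (p : ℝ) ^ (6 + (e - 4)) := (pow_add _ _ _).symm
      _ ≤ (p : ℝ) ^ etaExp e := pow_le_pow_right₀ (by linarith) (le_etaExp he)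
  refine (Real.rpow_le_rpow_of_nonpos (by positivity) hle (by norm_num)).trans_eq ?_
  rw [Real.mul_rpow (by positivity) (by positivity), ← Real.rpow_natCast_mul hp0.le,
    ← Real.rpow_natCast_mul zero_le_two, ← Real.rpow_mul_natCast zero_le_two]
  norm_num [mul_comm]

theorem summable_geometric_sub_four :
    Summable fun e : ℕ => ((2 : ℝ) ^ (-(3 / 16) : ℝ)) ^ (e - 4) := by
  rw [← summable_nat_add_iff 4]
  simpa using summable_geometric_of_lt_one (by positivity)
    (Real.rpow_lt_one_of_one_lt_of_neg (x := 2) (z := -(3 / 16)) (by norm_num) (by norm_num))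

theorem summable_etaProd_prime_pow {p : ℕ} (hp : p.Prime) :
    Summable fun e : ℕ => (etaProd (p ^ e) : ℝ) ^ (-(3 / 16) : ℝ) := by
  rw [← summable_nat_add_iff 1]
  exact Summable.of_nonneg_of_le (fun e => by positivity)
    (fun e => etaProd_prime_pow_rpow_le hp e.succ_ne_zero)
    (((summable_nat_add_iff 1).mpr summable_geometric_sub_four).mul_left _)

/-- Partial sums of `(b⁶c₁³c₂³)^{-3/16}` are bounded. -/
theorem exists_sum_etaProd_rpow_le :
    ∃ C : ℝ, 0 < C ∧ ∀ T : Finset ℕ, (∀ q ∈ T, q ≠ 0) →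
      ∑ q ∈ T, (etaProd q : ℝ) ^ (-(3 / 16) : ℝ) ≤ C := by
  set K : ℝ := ∑' e : ℕ, ((2 : ℝ) ^ (-(3 / 16) : ℝ)) ^ (e - 4) with hK
  have hK0 : 0 ≤ K := tsum_nonneg fun e => by positivity
  refine ⟨Real.exp (∑' n : ℕ, (n : ℝ) ^ (-(9 / 8) : ℝ) * K), Real.exp_pos _, fun T hT => ?_⟩
  refine sum_le_exp_tsum_of_local_factor_le (f := fun q => (etaProd q : ℝ) ^ (-(3 / 16) : ℝ))
    (by simp [etaProd_one]) (fun {m n} h => ?_) (fun n => by positivity)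
    summable_etaProd_prime_pow
    ((Real.summable_nat_rpow.mpr (by norm_num)).mul_right K) (fun n => by positivity)
    (fun {p} hp => ?_) T hT
  · rw [etaProd_mul h, Nat.cast_mul, Real.mul_rpow (by positivity) (by positivity)]
  · rw [(summable_etaProd_prime_pow hp).tsum_eq_zero_add]
    have hg := summable_geometric_sub_four
    gcongr
    · simp [etaProd_one]
    · calc ∑' e : ℕ, (etaProd (p ^ (e + 1)) : ℝ) ^ (-(3 / 16) : ℝ)
          ≤ ∑' e : ℕ, (p : ℝ) ^ (-(9 / 8) : ℝ) * ((2 : ℝ) ^ (-(3 / 16) : ℝ)) ^ (e + 1 - 4) :=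
            Summable.tsum_le_tsum (fun e => etaProd_prime_pow_rpow_le hp e.succ_ne_zero)
              ((summable_nat_add_iff 1).mpr (summable_etaProd_prime_pow hp))
              (((summable_nat_add_iff 1).mpr hg).mul_left _)
        _ = (p : ℝ) ^ (-(9 / 8) : ℝ) * ∑' e : ℕ, ((2 : ℝ) ^ (-(3 / 16) : ℝ)) ^ (e + 1 - 4) :=
            tsum_mul_left
        _ ≤ (p : ℝ) ^ (-(9 / 8) : ℝ) * K := by
            gcongr
            rw [hK, hg.tsum_eq_zero_add]
            simp

theorem one_le_rpow_mul_etaProd_rpow {d q : ℕ} (hd : 3 ≤ d) {R : ℝ} (hR : 1 ≤ R)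
    (h : etaOf d q ≤ R) :
    1 ≤ R ^ AdOf d * (etaProd q : ℝ) ^ (-(3 / 16) : ℝ) := by
  have hD : (8 : ℝ) ≤ (2 : ℝ) ^ (d : ℝ) := by
    rw [Real.rpow_natCast]
    calc (8 : ℝ) = 2 ^ 3 := by norm_num
      _ ≤ 2 ^ d := pow_le_pow_right₀ one_le_two hd
  have h2 : (2 : ℝ) ^ ((d : ℝ) - 2) = (2 : ℝ) ^ (d : ℝ) / 4 := by
    rw [Real.rpow_sub two_pos]
    norm_num
  have h4 : (2 : ℝ) ^ ((d : ℝ) - 4) = (2 : ℝ) ^ (d : ℝ) / 16 := by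
    rw [Real.rpow_sub two_pos]
    norm_num
  unfold etaOf at h
  unfold AdOf
  rw [h2] at h
  rw [h4]
  set D := (2 : ℝ) ^ (d : ℝ)
  obtain ⟨hX, hY⟩ := max_le_iff.mp h
  have hR0 : 0 < R := by linarith
  rw [one_div, Real.rpow_inv_le_iff_of_pos (by positivity) hR0.le (by linarith)] at hX hY
  have hprod : (etaProd q : ℝ) ≤ R ^ (9 * D / 4 - 6) := by
    calc (etaProd q : ℝ)
        = ((bOf q : ℝ) ^ 3 * c1Of q * (c2Of q : ℝ) ^ 2) *
            ((bOf q : ℝ) ^ 3 * (c1Of q : ℝ) ^ 2 * c2Of q) := by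
          rw [← etaProd_eq]
          push_cast
          ring
      _ ≤ R ^ (D - 2) * R ^ (5 * (D / 4) - 4) := by gcongr
      _ = R ^ (9 * D / 4 - 6) := by
          rw [← Real.rpow_add hR0]
          ring_nf
  have hpos : (0 : ℝ) < etaProd q := by exact_mod_cast etaProd_pos
  have hroot : (etaProd q : ℝ) ^ (3 / 16 : ℝ) ≤ R ^ (7 * (D / 16) - 5 / 4) := by
    calc (etaProd q : ℝ) ^ (3 / 16 : ℝ) ≤ (R ^ (9 * D / 4 - 6)) ^ (3 / 16 : ℝ) := by gcongr
      _ = R ^ ((9 * D / 4 - 6) * (3 / 16)) := (Real.rpow_mul hR0.le _ _).symm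
      _ ≤ R ^ (7 * (D / 16) - 5 / 4) := Real.rpow_le_rpow_of_exponent_le hR (by linarith)
  rw [Real.rpow_neg hpos.le, ← div_eq_mul_inv, one_le_div (by positivity)]
  exact hroot

/-- Lemma `restricted theta_q estimate`: `#{q ∈ ℕ : η_q ≤ R} ≪ R^{A_d}`. -/
theorem eta_count_bound (d : ℕ) (hd : 3 ≤ d) :
    ∃ C : ℝ, 0 < C ∧
      ∀ R : ℝ, 1 ≤ R →
        (Nat.card {q : ℕ // 0 < q ∧ etaOf d q ≤ R} : ℝ) ≤ C * R ^ AdOf d := by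
  obtain ⟨C, hC, hsum⟩ := exists_sum_etaProd_rpow_le
  refine ⟨C, hC, fun R hR => ?_⟩
  have hRA : 0 ≤ R ^ AdOf d := Real.rpow_nonneg (by linarith) _
  change (Nat.card ({q : ℕ | 0 < q ∧ etaOf d q ≤ R} : Set ℕ) : ℝ) ≤ _
  rw [Nat.card_coe_set_eq]
  rcases Set.finite_or_infinite {q : ℕ | 0 < q ∧ etaOf d q ≤ R} with hfin | hinf
  · rw [Set.ncard_eq_toFinset_card _ hfin]
    have hmem : ∀ q ∈ hfin.toFinset, 0 < q ∧ etaOf d q ≤ R := fun q hq => by simpa using hq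
    calc (hfin.toFinset.card : ℝ) = ∑ _q ∈ hfin.toFinset, (1 : ℝ) := by simp
      _ ≤ ∑ q ∈ hfin.toFinset, R ^ AdOf d * (etaProd q : ℝ) ^ (-(3 / 16) : ℝ) :=
          Finset.sum_le_sum fun q hq => one_le_rpow_mul_etaProd_rpow hd hR (hmem q hq).2
      _ = R ^ AdOf d * ∑ q ∈ hfin.toFinset, (etaProd q : ℝ) ^ (-(3 / 16) : ℝ) :=
          (Finset.mul_sum _ _ _).symm
      _ ≤ R ^ AdOf d * C :=
          mul_le_mul_of_nonneg_left (hsum _ fun q hq => (hmem q hq).1.ne') hRA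
      _ = C * R ^ AdOf d := mul_comm _ _
  · rw [hinf.ncard, Nat.cast_zero]
    positivity

end
end

section
/- Let d ≥ 3, let 3 ≤ k ≤ d, let σ ≥ 0 and n > σ, let 0 < Δ < d/3 and i ∈ {1, 2}. Suppose that for each ℓ ∈ {k, …, d} one has n − σ > A_d + (d/ℓ)·B_ℓ + (d/ℓ − 1)·(B_{ℓ+1} + V_{ℓ+1}). Then there exist δ > 0 and a function E(α, q) ≥ 0 of P ≥ 2, q ∈ ℕ and α ∈ 𝕋 such that: (a) M*(α, q) ≪ E(α, q) + ‖qα‖^{1/(B_k + V_k)} for all α, q; and (b) Σ_{q : P^{γᵢ} ≤ η_q ≤ P^γ} ∫_{ {α : P^{−dᵢ} ≤ ‖qα‖ ≤ P^{−ξ}} } E(α, q)^{n−σ} dα ≪ P^{−d−δ}, where d₁ := d + 2, d₂ := d − Δ, γ₁ := Δ/(5·2^{d−2} − 4), γ₂ := 0, and implicit constants depend only on d, n and Δ. -/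
noncomputable section
open scoped Classical
open MvPolynomial MeasureTheory

lemma prod_primeFactors_factorization_mul {M : Type*} [CommMonoid M] (g : ℕ → ℕ → M) {m n : ℕ}
    (h : Nat.Coprime m n) :
    ∏ p ∈ (m * n).primeFactors, g p ((m * n).factorization p) =
      (∏ p ∈ m.primeFactors, g p (m.factorization p)) *
        ∏ p ∈ n.primeFactors, g p (n.factorization p) := by
  rw [h.primeFactors_mul, Finset.prod_union h.disjoint_primeFactors]
  congr 1
  · refine Finset.prod_congr rfl fun p hp => ?_
    rw [Nat.factorization_eq_of_coprime_left h (by simpa using hp)]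
  · refine Finset.prod_congr rfl fun p hp => ?_
    rw [Nat.factorization_eq_of_coprime_right h (by simpa using hp)]

lemma summable_of_multiplicative_of_prime_pow_le {f : ℕ → ℝ} (hf : ∀ n, 0 ≤ f n) (hf₁ : f 1 = 1)
    (hmul : ∀ {m n}, Nat.Coprime m n → f (m * n) = f m * f n) {C a r : ℝ} (ha : 1 < a)
    (hr₀ : 0 ≤ r) (hr₁ : r < 1)
    (hle : ∀ p e : ℕ, p.Prime → e ≠ 0 → f (p ^ e) ≤ C * (p : ℝ) ^ (-a) * r ^ e) :
    Summable f := by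
  have hgeo := summable_geometric_of_lt_one hr₀ hr₁
  have hC : 0 ≤ C * r := by
    have h := (hf _).trans (hle 2 1 Nat.prime_two one_ne_zero)
    rw [pow_one, mul_right_comm] at h
    exact nonneg_of_mul_nonneg_left h (by positivity)
  have hsucc : ∀ p : ℕ, p.Prime → Summable fun e : ℕ => f (p ^ (e + 1)) := fun p hp =>
    Summable.of_nonneg_of_le (fun _ => hf _) (fun e => hle p (e + 1) hp e.succ_ne_zero)
      (((summable_nat_add_iff 1).2 hgeo).mul_left _)
  have hpow : ∀ p : ℕ, p.Prime → Summable fun e : ℕ => f (p ^ e) := fun p hp =>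
    (summable_nat_add_iff (f := fun e : ℕ => f (p ^ e)) 1).1 (hsucc p hp)
  set D := C * r * (1 - r)⁻¹ with hD
  have hD₀ : 0 ≤ D := mul_nonneg hC (inv_nonneg.2 (by linarith))
  have hlocal : ∀ p : ℕ, p.Prime → ∑' e : ℕ, f (p ^ e) ≤ 1 + D * (p : ℝ) ^ (-a) := fun p hp => by
    rw [(hpow p hp).tsum_eq_zero_add, pow_zero, hf₁]
    gcongr
    refine (Summable.tsum_le_tsum (fun e => hle p (e + 1) hp e.succ_ne_zero) (hsucc p hp)
      (((summable_nat_add_iff 1).2 hgeo).mul_left _)).trans_eq ?_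
    simp_rw [pow_succ]
    rw [tsum_mul_left, tsum_mul_right, tsum_geometric_of_lt_one hr₀ hr₁, hD]
    ring
  have hps : Summable fun n : ℕ => D * (n : ℝ) ^ (-a) :=
    (Real.summable_nat_rpow.2 (by linarith)).mul_left D
  refine (summable_nat_add_iff 1).1 (summable_of_sum_range_le (fun n => hf (n + 1))
    (c := Real.exp (∑' n : ℕ, D * (n : ℝ) ^ (-a))) fun n => ?_)
  have hs := (EulerProduct.summable_and_hasSum_smoothNumbers_prod_primesBelow_tsum hf₁ hmul
    (fun {p} hp => (hpow p hp).norm) (n + 1)).2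
  have hs' : HasSum ((n + 1).smoothNumbers.indicator f)
      (∏ p ∈ (n + 1).primesBelow, ∑' e : ℕ, f (p ^ e)) := hasSum_subtype_iff_indicator.1 hs
  calc ∑ i ∈ Finset.range n, f (i + 1)
      = ∑ i ∈ (Finset.range n).map ⟨Nat.succ, Nat.succ_injective⟩,
          (n + 1).smoothNumbers.indicator f i := by
        rw [Finset.sum_map]
        refine Finset.sum_congr rfl fun i hi => ?_
        rw [Set.indicator_of_mem]
        · rfl
        · exact Nat.mem_smoothNumbers_of_lt i.succ_pos
            (Nat.succ_lt_succ (Finset.mem_range.1 hi))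
    _ ≤ ∏ p ∈ (n + 1).primesBelow, ∑' e : ℕ, f (p ^ e) :=
        sum_le_hasSum _ (fun i _ => Set.indicator_nonneg (fun _ _ => hf _) i) hs'
    _ ≤ ∏ p ∈ (n + 1).primesBelow, (1 + D * (p : ℝ) ^ (-a)) :=
        Finset.prod_le_prod (fun p _ => tsum_nonneg fun e => hf _)
          fun p hp => hlocal p (Nat.prime_of_mem_primesBelow hp)
    _ ≤ Real.exp (∑ p ∈ (n + 1).primesBelow, D * (p : ℝ) ^ (-a)) :=
        Real.prod_one_add_le_exp_sum _ fun p => by positivity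
    _ ≤ _ := Real.exp_le_exp.2 (hps.sum_le_tsum _ fun i _ => by positivity)

/-- The function `b^{-9/8} c₁^{-5/8} c₂^{-1/2}` of `q`, written in terms of the two products
occurring in `η_q`. -/
def etaWeight (q : ℕ) : ℝ :=
  (((bOf q : ℝ) ^ 3 * (c1Of q : ℝ) * (c2Of q : ℝ) ^ 2) ^ (1 / 8 : ℝ) *
    ((bOf q : ℝ) ^ 3 * (c1Of q : ℝ) ^ 2 * (c2Of q : ℝ)) ^ (1 / 4 : ℝ))⁻¹

lemma etaWeight_nonneg (q : ℕ) : 0 ≤ etaWeight q := by unfold etaWeight; positivity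

lemma bOf_mul {m n : ℕ} (h : Nat.Coprime m n) : bOf (m * n) = bOf m * bOf n :=
  prod_primeFactors_factorization_mul (fun p e => if e ≤ 2 then p ^ e else 1) h

lemma c1Of_mul {m n : ℕ} (h : Nat.Coprime m n) : c1Of (m * n) = c1Of m * c1Of n :=
  prod_primeFactors_factorization_mul (fun p e => if 2 < e then p ^ (e / 2) else 1) h

lemma c2Of_mul {m n : ℕ} (h : Nat.Coprime m n) : c2Of (m * n) = c2Of m * c2Of n :=
  prod_primeFactors_factorization_mul (fun p e => if 2 < e ∧ Odd e then p else 1) h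

lemma etaWeight_mul {m n : ℕ} (h : Nat.Coprime m n) :
    etaWeight (m * n) = etaWeight m * etaWeight n := by
  unfold etaWeight
  rw [bOf_mul h, c1Of_mul h, c2Of_mul h, ← mul_inv, mul_mul_mul_comm,
    ← Real.mul_rpow (by positivity) (by positivity), ← Real.mul_rpow (by positivity) (by positivity)]
  push_cast
  ring_nf

lemma etaWeight_one : etaWeight 1 = 1 := by simp [etaWeight, bOf, c1Of, c2Of]

lemma exists_eta_factors_prime_pow {p e : ℕ} (hp : p.Prime) (he : e ≠ 0) :
    ∃ i j : ℕ, bOf (p ^ e) ^ 3 * c1Of (p ^ e) * c2Of (p ^ e) ^ 2 = p ^ i ∧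
      bOf (p ^ e) ^ 3 * c1Of (p ^ e) ^ 2 * c2Of (p ^ e) = p ^ j ∧
      9 ≤ i + 2 * j ∧ e + 5 ≤ i + 2 * j := by
  have hb : bOf (p ^ e) = if e ≤ 2 then p ^ e else 1 := by
    simp [bOf, Nat.primeFactors_prime_pow he hp, hp.factorization_self]
  have hc₁ : c1Of (p ^ e) = if 2 < e then p ^ (e / 2) else 1 := by
    simp [c1Of, Nat.primeFactors_prime_pow he hp, hp.factorization_self]
  have hc₂ : c2Of (p ^ e) = if 2 < e ∧ Odd e then p else 1 := by
    simp [c2Of, Nat.primeFactors_prime_pow he hp, hp.factorization_self]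
  rw [hb, hc₁, hc₂]
  rcases le_or_gt e 2 with h | h
  · refine ⟨e * 3, e * 3, ?_, ?_, by omega, by omega⟩ <;> simp [h, h.not_gt, pow_mul]
  · rcases Nat.even_or_odd e with ho | ho
    · refine ⟨e / 2, e / 2 * 2, ?_, ?_, ?_⟩
      · simp [h, h.not_ge, Nat.not_odd_iff_even.2 ho]
      · simp [h, h.not_ge, Nat.not_odd_iff_even.2 ho, pow_mul]
      · obtain ⟨c, rfl⟩ := ho
        omega
    · refine ⟨e / 2 + 2, e / 2 * 2 + 1, ?_, ?_, ?_⟩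
      · simp [h, h.not_ge, ho, pow_add]
      · simp [h, h.not_ge, ho, pow_mul, pow_succ]
      · obtain ⟨c, rfl⟩ := ho
        omega

lemma etaWeight_prime_pow_le {p e : ℕ} (hp : p.Prime) (he : e ≠ 0) :
    etaWeight (p ^ e) ≤ (2 : ℝ) ^ (1 / 2 : ℝ) * (p : ℝ) ^ (-(9 / 8) : ℝ) *
      ((2 : ℝ) ^ (-(1 / 8) : ℝ)) ^ e := by
  obtain ⟨i, j, hi, hj, h9, h5⟩ := exists_eta_factors_prime_pow hp he
  have hp2 : (2 : ℝ) ≤ p := by exact_mod_cast hp.two_le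
  have hp0 : (0 : ℝ) < p := by linarith
  have hi' : (bOf (p ^ e) : ℝ) ^ 3 * (c1Of (p ^ e) : ℝ) * (c2Of (p ^ e) : ℝ) ^ 2 = (p : ℝ) ^ i := by
    exact_mod_cast hi
  have hj' : (bOf (p ^ e) : ℝ) ^ 3 * (c1Of (p ^ e) : ℝ) ^ 2 * (c2Of (p ^ e) : ℝ) = (p : ℝ) ^ j := by
    exact_mod_cast hj
  obtain ⟨m, hm⟩ := Nat.exists_eq_add_of_le h9
  have hm' : (i : ℝ) + 2 * j = 9 + m := by exact_mod_cast hm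
  have hme : (e : ℝ) ≤ 4 + m := by
    have : e ≤ 4 + m := by omega
    exact_mod_cast this
  unfold etaWeight
  rw [hi', hj', ← Real.rpow_natCast, ← Real.rpow_natCast, ← Real.rpow_mul hp0.le,
    ← Real.rpow_mul hp0.le, ← Real.rpow_add hp0, ← Real.rpow_neg hp0.le]
  have hexp : -((i : ℝ) * (1 / 8) + j * (1 / 4)) = -(9 / 8) + -(m / 8) := by linarith
  rw [hexp, Real.rpow_add hp0, mul_comm ((2 : ℝ) ^ (1 / 2 : ℝ)), mul_assoc, ← Real.rpow_natCast,
    ← Real.rpow_mul two_pos.le, ← Real.rpow_add two_pos]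
  gcongr
  calc (p : ℝ) ^ (-((m : ℝ) / 8)) ≤ (2 : ℝ) ^ (-((m : ℝ) / 8)) :=
        Real.rpow_le_rpow_of_nonpos two_pos hp2 (neg_nonpos.2 (by positivity))
    _ ≤ _ := Real.rpow_le_rpow_of_exponent_le one_le_two (by linarith)

lemma summable_etaWeight : Summable etaWeight :=
  summable_of_multiplicative_of_prime_pow_le etaWeight_nonneg etaWeight_one etaWeight_mul
    (by norm_num) (by positivity) (Real.rpow_lt_one_of_one_lt_of_neg one_lt_two (by norm_num))
    fun _ _ => etaWeight_prime_pow_le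

lemma bOf_pos (q : ℕ) : 0 < bOf q := Finset.prod_pos fun p hp => by
  have := (Nat.prime_of_mem_primeFactors hp).pos
  split_ifs <;> positivity

lemma c1Of_pos (q : ℕ) : 0 < c1Of q := Finset.prod_pos fun p hp => by
  have := (Nat.prime_of_mem_primeFactors hp).pos
  split_ifs <;> positivity

lemma c2Of_pos (q : ℕ) : 0 < c2Of q := Finset.prod_pos fun p hp => by
  have := (Nat.prime_of_mem_primeFactors hp).pos
  split_ifs <;> positivity

lemma etaOf_pos (d q : ℕ) : 0 < etaOf d q := by
  have := bOf_pos q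
  have := c1Of_pos q
  have := c2Of_pos q
  exact lt_max_of_lt_left (by positivity)

lemma AdOf_pos {d : ℕ} (hd : 3 ≤ d) : 0 < AdOf d := by
  have hd' : (3 : ℝ) ≤ d := by exact_mod_cast hd
  have h : (2 : ℝ) ^ (-1 : ℝ) ≤ (2 : ℝ) ^ ((d : ℝ) - 4) :=
    Real.rpow_le_rpow_of_exponent_le one_le_two (by linarith)
  rw [Real.rpow_neg_one] at h
  unfold AdOf
  linarith

lemma etaOf_rpow_le {d q : ℕ} (hd : 3 ≤ d) : etaOf d q ^ (-AdOf d) ≤ etaWeight q := by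
  have hd' : (3 : ℝ) ≤ d := by exact_mod_cast hd
  have := bOf_pos q
  have := c1Of_pos q
  have := c2Of_pos q
  have hη := etaOf_pos d q
  obtain ⟨u, hu⟩ : ∃ u, u = (2 : ℝ) ^ ((d : ℝ) - 4) := ⟨_, rfl⟩
  have h₁ : (2 : ℝ) ^ (d : ℝ) = 16 * u := by
    rw [hu, Real.rpow_sub two_pos, show (4 : ℝ) = (4 : ℕ) by norm_num, Real.rpow_natCast]; ring
  have h₂ : (2 : ℝ) ^ ((d : ℝ) - 2) = 4 * u := by
    rw [hu, show (d : ℝ) - 4 = d - 2 - 2 by ring, Real.rpow_sub two_pos ((d : ℝ) - 2)]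
    norm_num
    ring
  have hu₀ : 1 / 2 ≤ u := by
    have h : (2 : ℝ) ^ (-1 : ℝ) ≤ (2 : ℝ) ^ ((d : ℝ) - 4) :=
      Real.rpow_le_rpow_of_exponent_le one_le_two (by linarith)
    rw [Real.rpow_neg_one] at h
    rw [hu]; linarith
  have key : ∀ {x e : ℝ}, 0 < x → 0 < e → x ^ (1 / e) ≤ etaOf d q → x ≤ etaOf d q ^ e := by
    intro x e hx he h
    have := Real.rpow_le_rpow (by positivity) h he.le
    rwa [← Real.rpow_mul hx.le, one_div_mul_cancel he.ne', Real.rpow_one] at this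
  have k₁ := key (x := (bOf q : ℝ) ^ 3 * (c1Of q : ℝ) * (c2Of q : ℝ) ^ 2) (by positivity)
    (by rw [h₁]; linarith) (le_max_left _ _)
  have k₂ := key (x := (bOf q : ℝ) ^ 3 * (c1Of q : ℝ) ^ 2 * (c2Of q : ℝ)) (by positivity)
    (by rw [h₂]; linarith) (le_max_right _ _)
  rw [Real.rpow_neg hη.le, etaWeight]
  refine inv_anti₀ (by positivity) ?_
  calc _ ≤ (etaOf d q ^ ((2 : ℝ) ^ (d : ℝ) - 2)) ^ (1 / 8 : ℝ) *
        (etaOf d q ^ (5 * (2 : ℝ) ^ ((d : ℝ) - 2) - 4)) ^ (1 / 4 : ℝ) := by gcongr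
    _ = etaOf d q ^ AdOf d := by
      rw [← Real.rpow_mul hη.le, ← Real.rpow_mul hη.le, ← Real.rpow_add hη, h₁, h₂, AdOf, ← hu]
      congr 1
      ring

/-- A 1-periodic majorant of `‖x‖ ^ s`. -/
def fractMajorant (s x : ℝ) : ℝ := Int.fract x ^ s + (1 - Int.fract x) ^ s

lemma nint_rpow_le_fractMajorant (s x : ℝ) : nint x ^ s ≤ fractMajorant s x := by
  have h₀ := Int.fract_nonneg x
  have h₁ : 0 ≤ 1 - Int.fract x := by linarith [Int.fract_lt_one x]
  unfold nint fractMajorant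
  rw [abs_sub_round_eq_min]
  rcases min_choice (Int.fract x) (1 - Int.fract x) with h | h <;> rw [h]
  · exact le_add_of_nonneg_right (Real.rpow_nonneg h₁ _)
  · exact le_add_of_nonneg_left (Real.rpow_nonneg h₀ _)

lemma fractMajorant_periodic (s : ℝ) : Function.Periodic (fractMajorant s) 1 := fun x => by
  simp [fractMajorant]

lemma fractMajorant_nonneg (s x : ℝ) : 0 ≤ fractMajorant s x := by
  have h₁ : 0 ≤ 1 - Int.fract x := by linarith [Int.fract_lt_one x]
  exact add_nonneg (Real.rpow_nonneg (Int.fract_nonneg x) _) (Real.rpow_nonneg h₁ _)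

lemma fractMajorant_of_mem {s x : ℝ} (hx : x ∈ Set.Ioo (0 : ℝ) 1) :
    fractMajorant s x = x ^ s + (1 - x) ^ s := by
  unfold fractMajorant
  rw [Int.fract_eq_self.2 ⟨hx.1.le, hx.2⟩]

lemma intervalIntegrable_one_sub_rpow {s : ℝ} (hs : -1 < s) :
    IntervalIntegrable (fun x : ℝ => (1 - x) ^ s) volume 0 1 := by
  simpa using ((intervalIntegral.intervalIntegrable_rpow' hs (a := 0) (b := 1)).comp_sub_left 1).symm

lemma intervalIntegrable_fractMajorant {s : ℝ} (hs : -1 < s) :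
    IntervalIntegrable (fractMajorant s) volume 0 1 := by
  refine ((intervalIntegral.intervalIntegrable_rpow' hs).add
    (intervalIntegrable_one_sub_rpow hs)).congr_uIoo fun x hx => ?_
  rw [Set.uIoo_of_le zero_le_one] at hx
  exact (fractMajorant_of_mem hx).symm

lemma integral_fractMajorant {s : ℝ} (hs : -1 < s) :
    ∫ x in (0 : ℝ)..1, fractMajorant s x = 2 / (s + 1) := by
  have hs' : s + 1 ≠ 0 := by linarith
  have h₁ : ∫ x in (0 : ℝ)..1, x ^ s = 1 / (s + 1) := by
    rw [integral_rpow (Or.inl hs), Real.one_rpow, Real.zero_rpow hs', sub_zero]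
  have h₂ : ∫ x in (0 : ℝ)..1, (1 - x) ^ s = 1 / (s + 1) := by
    rw [intervalIntegral.integral_comp_sub_left (fun x => x ^ s) 1]
    simpa using h₁
  have h₃ : ∫ x in (0 : ℝ)..1, fractMajorant s x = ∫ x in (0 : ℝ)..1, (x ^ s + (1 - x) ^ s) := by
    rw [intervalIntegral.integral_of_le zero_le_one, intervalIntegral.integral_of_le zero_le_one,
      integral_Ioc_eq_integral_Ioo, integral_Ioc_eq_integral_Ioo]
    exact setIntegral_congr_fun measurableSet_Ioo fun x hx => fractMajorant_of_mem hx
  rw [h₃, intervalIntegral.integral_add (intervalIntegral.intervalIntegrable_rpow' hs)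
    (intervalIntegrable_one_sub_rpow hs), h₁, h₂]
  ring

lemma integrableOn_fractMajorant_mul {s : ℝ} (hs : -1 < s) {q : ℕ} (hq : 0 < q) :
    IntegrableOn (fun x => fractMajorant s (q * x)) (Set.Ico 0 1) := by
  have hq' : (q : ℝ) ≠ 0 := by positivity
  have h := ((fractMajorant_periodic s).intervalIntegrable₀ one_ne_zero
    (intervalIntegrable_fractMajorant hs) 0 q).comp_mul_left (c := (q : ℝ))
  rw [zero_div, div_self hq'] at h
  rw [integrableOn_Ico_iff_integrableOn_Ioo, ← integrableOn_Ioc_iff_integrableOn_Ioo]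
  exact (intervalIntegrable_iff_integrableOn_Ioc_of_le zero_le_one).1 h

lemma setIntegral_fractMajorant_mul {s : ℝ} (hs : -1 < s) {q : ℕ} (hq : 0 < q) :
    ∫ x in Set.Ico (0 : ℝ) 1, fractMajorant s (q * x) = 2 / (s + 1) := by
  have hq' : (q : ℝ) ≠ 0 := by positivity
  have hper := (fractMajorant_periodic s).intervalIntegral_add_zsmul_eq q 0
    ((fractMajorant_periodic s).intervalIntegrable₀ one_ne_zero
      (intervalIntegrable_fractMajorant hs))
  simp only [zero_add, zsmul_eq_mul, Int.cast_natCast, mul_one] at hper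
  rw [integral_Ico_eq_integral_Ioo, ← integral_Ioc_eq_integral_Ioo,
    ← intervalIntegral.integral_of_le zero_le_one,
    intervalIntegral.integral_comp_mul_left (fractMajorant s) hq', mul_zero, mul_one, hper,
    integral_fractMajorant hs, smul_eq_mul, inv_mul_cancel_left₀ hq']

lemma exists_le_and_le_succ_of_lt {a b : ℕ → ℝ} {m : ℝ} {k d : ℕ} (hkd : k ≤ d)
    (h : ∀ l, k ≤ l → l ≤ d → m ≤ max (a l) (b l)) (hk : a k < m) :
    ∃ l ∈ Finset.Icc k d, m ≤ b l ∧ (l = d ∨ l < d ∧ m ≤ a (l + 1)) := by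
  by_contra! hcon
  have hlt : ∀ l, k ≤ l → l ≤ d → a l < m := by
    intro l hkl
    induction l, hkl using Nat.le_induction with
    | base => exact fun _ => hk
    | succ l hkl ih =>
      intro hl
      have hb : m ≤ b l := (le_max_iff.1 (h l hkl (by omega))).resolve_left
        (ih (by omega)).not_ge
      exact (hcon l (Finset.mem_Icc.2 ⟨hkl, by omega⟩) hb).2 (by omega)
  exact (hcon d (Finset.mem_Icc.2 ⟨hkd, le_rfl⟩) ((le_max_iff.1 (h d hkd le_rfl)).resolve_left
    (hlt d hkd le_rfl).not_ge)).1 rfl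

lemma Finset.exists_pos_forall_of_forall_exists_pos {ι : Type*} (S : Finset ι) {p : ι → ℝ → Prop}
    (hmono : ∀ i x y, 0 < x → x ≤ y → p i y → p i x) (h : ∀ i ∈ S, ∃ x, 0 < x ∧ p i x) :
    ∃ x, 0 < x ∧ ∀ i ∈ S, p i x := by
  induction S using Finset.induction with
  | empty => exact ⟨1, one_pos, by simp⟩
  | insert i S _ ih =>
    obtain ⟨x, hx, hxS⟩ := ih fun j hj => h j (Finset.mem_insert_of_mem hj)
    obtain ⟨y, hy, hyi⟩ := h i (Finset.mem_insert_self _ _)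
    refine ⟨min x y, lt_min hx hy, fun j hj => ?_⟩
    rcases Finset.mem_insert.1 hj with rfl | hj
    · exact hmono _ _ _ (lt_min hx hy) (min_le_right _ _) hyi
    · exact hmono _ _ _ (lt_min hx hy) (min_le_left _ _) (hxS j hj)

lemma BkOf_pos {d l : ℕ} (hl : 2 ≤ l) : 0 < BkOf d l := by
  have : (2 : ℝ) ≤ l := by exact_mod_cast hl
  exact mul_pos (by linarith) (by positivity)

lemma VkOf_nonneg {d l : ℕ} (hl : l ≤ d) : 0 ≤ VkOf d l := by
  have hl' : (l : ℝ) ≤ d := by exact_mod_cast hl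
  have : (2 : ℝ) ^ (1 : ℝ) ≤ (2 : ℝ) ^ ((d : ℝ) + 1 - l) :=
    Real.rpow_le_rpow_of_exponent_le one_le_two (by linarith)
  rw [Real.rpow_one] at this
  exact sub_nonneg.2 this

lemma xiOf_pos {d : ℕ} (hd : 3 ≤ d) : 0 < xiOf d := by
  have hd' : (3 : ℝ) ≤ d := by exact_mod_cast hd
  have h₁ : (2 : ℝ) ^ ((4 : ℝ) - d) ≤ (2 : ℝ) ^ (1 : ℝ) :=
    Real.rpow_le_rpow_of_exponent_le one_le_two (by linarith)
  have h₂ : (2 : ℝ) ^ ((3 : ℝ) - d) ≤ (2 : ℝ) ^ (0 : ℝ) :=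
    Real.rpow_le_rpow_of_exponent_le one_le_two (by linarith)
  rw [Real.rpow_one] at h₁
  rw [Real.rpow_zero] at h₂
  exact div_pos (by linarith) (by linarith)

lemma WSof_nonneg (d l : ℕ) (P : ℝ) (q : ℕ) (α : ℝ) : 0 ≤ WSof d l P q α :=
  le_max_of_le_left (Real.rpow_nonneg (nint_nonneg _) _)

lemma MSof_nonneg (d : ℕ) (P : ℝ) (q : ℕ) (α : ℝ) : 0 ≤ MSof d P q α :=
  Real.sInf_nonneg (by rintro _ ⟨l, _, rfl⟩; exact WSof_nonneg ..)

lemma MSof_le_WSof {d l : ℕ} (hl : 3 ≤ l) (hld : l ≤ d) (P : ℝ) (q : ℕ) (α : ℝ) :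
    MSof d P q α ≤ WSof d l P q α :=
  csInf_le ⟨0, by rintro _ ⟨l, _, rfl⟩; exact WSof_nonneg ..⟩ ⟨l, ⟨hl, hld⟩, rfl⟩

lemma rpow_le_of_le_min {M η t P s A B D lam κ ρ l d : ℝ} (hM : 0 < M) (hM₁ : M ≤ 1)
    (hη : 0 < η) (ht : 0 < t) (hP : 0 < P) (hA : 0 ≤ A) (hB : 0 < B) (hlam : 1 ≤ lam)
    (hρ : 0 ≤ ρ) (hl : l * lam = d) (hs : A + lam * B + (lam - 1) * D + ρ ≤ s)
    (hMη : M ≤ η⁻¹) (hMt : M ≤ (t * P ^ l) ^ (-(1 / B)))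
    (hMD : lam = 1 ∨ 0 < D ∧ M ≤ t ^ (1 / D)) (hMP : M ≤ P ^ (-κ)) :
    M ^ s ≤ η ^ (-A) * P ^ (-d - κ * ρ) * t⁻¹ := by
  have h₁ : M ^ A ≤ η ^ (-A) := by
    rw [Real.rpow_neg hη.le, ← Real.inv_rpow hη.le]
    exact Real.rpow_le_rpow hM.le hMη hA
  have h₂ : M ^ (lam * B) ≤ t ^ (-lam) * P ^ (-d) := by
    refine (Real.rpow_le_rpow hM.le hMt (by positivity)).trans_eq ?_
    rw [← Real.rpow_mul (by positivity), show -(1 / B) * (lam * B) = -lam by field_simp,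
      Real.mul_rpow ht.le (by positivity), ← Real.rpow_mul hP.le, ← hl]
    ring_nf
  have h₃ : M ^ ((lam - 1) * D) ≤ t ^ (lam - 1) := by
    rcases hMD with rfl | ⟨hD, hMD⟩
    · simp
    · refine (Real.rpow_le_rpow hM.le hMD (mul_nonneg (by linarith) hD.le)).trans_eq ?_
      rw [← Real.rpow_mul ht.le]
      congr 1
      field_simp
  have h₄ : M ^ ρ ≤ P ^ (-(κ * ρ)) := by
    refine (Real.rpow_le_rpow hM.le hMP hρ).trans_eq ?_
    rw [← Real.rpow_mul hP.le]
    ring_nf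
  calc M ^ s ≤ M ^ (A + lam * B + (lam - 1) * D + ρ) :=
        Real.rpow_le_rpow_of_exponent_ge hM hM₁ hs
    _ = M ^ A * M ^ (lam * B) * M ^ ((lam - 1) * D) * M ^ ρ := by
        rw [Real.rpow_add hM, Real.rpow_add hM, Real.rpow_add hM]
    _ ≤ η ^ (-A) * (t ^ (-lam) * P ^ (-d)) * t ^ (lam - 1) * P ^ (-(κ * ρ)) := by gcongr
    _ = η ^ (-A) * (P ^ (-d) * P ^ (-(κ * ρ))) * (t ^ (-lam) * t ^ (lam - 1)) := by ring
    _ = _ := by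
        rw [← Real.rpow_add hP, ← Real.rpow_add ht, ← Real.rpow_neg_one]
        ring_nf

/-- The bound for `M = M*(α, q)`, with `t = ‖qα‖` and `η = η_q`, in the range where `M` is
controlled by the `l`-th term. -/
def SavingAt (d n σ : ℕ) (di γi : ℝ) (l : ℕ) (δ : ℝ) : Prop :=
  ∀ P M η t : ℝ, 2 ≤ P → 0 < M → P ^ γi ≤ η → P ^ (-di) ≤ t → t ≤ P ^ (-(xiOf d)) →
    M ≤ η⁻¹ → M ≤ (t * P ^ (l : ℝ)) ^ (-(1 / BkOf d l)) →
    (l = d ∨ l < d ∧ M ≤ t ^ (1 / (BkOf d (l + 1) + VkOf d (l + 1)))) →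
    M ^ ((n : ℝ) - σ) ≤ η ^ (-AdOf d) * P ^ (-(d : ℝ) - δ) * t⁻¹

lemma SavingAt.mono {d n σ : ℕ} {di γi : ℝ} {l : ℕ} {δ δ' : ℝ} (h : δ ≤ δ')
    (hδ' : SavingAt d n σ di γi l δ') : SavingAt d n σ di γi l δ := by
  intro P M η t hP hM hη ht ht' h₁ h₂ h₃
  have hP₀ : 0 < P := by linarith
  have hη₀ : 0 < η := (Real.rpow_pos_of_pos hP₀ _).trans_le hη
  have ht₀ : 0 < t := (Real.rpow_pos_of_pos hP₀ _).trans_le ht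
  refine (hδ' P M η t hP hM hη ht ht' h₁ h₂ h₃).trans ?_
  gcongr
  linarith

lemma exists_savingAt {d n σ : ℕ} (hd : 3 ≤ d) {Δ di γi : ℝ} (hΔ : 0 < Δ)
    (hi : (di = (d : ℝ) + 2 ∧ γi = Δ / (5 * (2:ℝ) ^ ((d : ℝ) - 2) - 4)) ∨
      (di = (d : ℝ) - Δ ∧ γi = 0)) {l : ℕ} (hl : 3 ≤ l) (hld : l ≤ d)
    (hcond : AdOf d + (d : ℝ) / l * BkOf d l +
      ((d : ℝ) / l - 1) * (BkOf d (l + 1) + VkOf d (l + 1)) < (n : ℝ) - (σ : ℝ)) :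
    ∃ δ, 0 < δ ∧ SavingAt d n σ di γi l δ := by
  have hd' : (3 : ℝ) ≤ d := by exact_mod_cast hd
  have hl₀ : (0 : ℝ) < l := by
    have : 0 < l := by omega
    exact_mod_cast this
  have hld' : (l : ℝ) ≤ d := by exact_mod_cast hld
  have hB : 0 < BkOf d l := BkOf_pos (by omega)
  have hγ₁ : 0 < Δ / (5 * (2:ℝ) ^ ((d : ℝ) - 2) - 4) := by
    have : (2 : ℝ) ^ (1 : ℝ) ≤ (2 : ℝ) ^ ((d : ℝ) - 2) :=
      Real.rpow_le_rpow_of_exponent_le one_le_two (by linarith)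
    rw [Real.rpow_one] at this
    exact div_pos hΔ (by linarith)
  have hγi : 0 ≤ γi := by
    rcases hi with ⟨_, rfl⟩ | ⟨_, rfl⟩
    · exact hγ₁.le
    · exact le_rfl
  obtain ⟨ρ, hρ⟩ : ∃ ρ, ρ = (n : ℝ) - σ - (AdOf d + (d : ℝ) / l * BkOf d l +
      ((d : ℝ) / l - 1) * (BkOf d (l + 1) + VkOf d (l + 1))) := ⟨_, rfl⟩
  have hρ₀ : 0 < ρ := by linarith
  obtain ⟨κ, hκ, hMκ⟩ : ∃ κ : ℝ, 0 < κ ∧ ∀ P M η t : ℝ, 2 ≤ P → 0 < M → P ^ γi ≤ η →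
      P ^ (-di) ≤ t → t ≤ P ^ (-(xiOf d)) → M ≤ η⁻¹ →
      M ≤ (t * P ^ (l : ℝ)) ^ (-(1 / BkOf d l)) →
      (l = d ∨ l < d ∧ M ≤ t ^ (1 / (BkOf d (l + 1) + VkOf d (l + 1)))) → M ≤ P ^ (-κ) := by
    rcases hld.lt_or_eq with hlt | rfl
    · have hD : 0 < BkOf d (l + 1) + VkOf d (l + 1) :=
        add_pos_of_pos_of_nonneg (BkOf_pos (by omega)) (VkOf_nonneg hlt)
      refine ⟨_, div_pos (xiOf_pos hd) hD, fun P M η t hP hM hη ht ht' _ _ h => ?_⟩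
      have hP₀ : 0 < P := by linarith
      have ht₀ : 0 < t := (Real.rpow_pos_of_pos hP₀ _).trans_le ht
      refine (h.resolve_left hlt.ne).2.trans
        ((Real.rpow_le_rpow ht₀.le ht' (by positivity)).trans_eq ?_)
      rw [← Real.rpow_mul hP₀.le]
      ring_nf
    · rcases hi with ⟨_, rfl⟩ | ⟨rfl, _⟩
      · refine ⟨_, hγ₁, fun P M η t hP hM hη _ _ h _ _ => h.trans ?_⟩
        have hP₀ : 0 < P := by linarith
        rw [Real.rpow_neg hP₀.le]
        exact inv_anti₀ (by positivity) hη
      · refine ⟨_, div_pos hΔ hB, fun P M η t hP hM hη ht _ _ h _ => h.trans ?_⟩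
        have hP₀ : 0 < P := by linarith
        have h₁ : P ^ Δ ≤ t * P ^ (l : ℝ) := by
          calc P ^ Δ = P ^ (-((l : ℝ) - Δ)) * P ^ (l : ℝ) := by
                rw [← Real.rpow_add hP₀]
                ring_nf
            _ ≤ _ := by gcongr
        refine (Real.rpow_le_rpow_of_nonpos (by positivity) h₁
          (neg_nonpos.2 (by positivity))).trans_eq ?_
        rw [← Real.rpow_mul hP₀.le]
        ring_nf
  refine ⟨κ * ρ, by positivity, fun P M η t hP hM hη ht ht' h₁ h₂ h₃ => ?_⟩
  have hP₀ : 0 < P := by linarith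
  have hη₁ : 1 ≤ η := (Real.one_le_rpow (by linarith) hγi).trans hη
  have ht₀ : 0 < t := (Real.rpow_pos_of_pos hP₀ _).trans_le ht
  refine rpow_le_of_le_min hM (h₁.trans (inv_le_one_of_one_le₀ hη₁)) (by linarith) ht₀ hP₀
    (AdOf_pos hd).le hB ((one_le_div hl₀).2 hld') hρ₀.le (mul_div_cancel₀ _ hl₀.ne')
    (D := BkOf d (l + 1) + VkOf d (l + 1)) (by linarith) h₁ h₂ ?_
    (hMκ P M η t hP hM hη ht ht' h₁ h₂ h₃)
  rcases h₃ with rfl | ⟨hlt, h₃⟩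
  · exact Or.inl (div_self hl₀.ne')
  · exact Or.inr ⟨add_pos_of_pos_of_nonneg (BkOf_pos (by omega)) (VkOf_nonneg hlt), h₃⟩

lemma exists_MSof_rpow_le {d k n σ : ℕ} (hd : 3 ≤ d) (hk : 3 ≤ k) (hkd : k ≤ d) {Δ di γi : ℝ}
    (hΔ : 0 < Δ)
    (hi : (di = (d : ℝ) + 2 ∧ γi = Δ / (5 * (2:ℝ) ^ ((d : ℝ) - 2) - 4)) ∨
      (di = (d : ℝ) - Δ ∧ γi = 0))
    (hcond : ∀ l : ℕ, k ≤ l → l ≤ d →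
      AdOf d + (d : ℝ) / l * BkOf d l + ((d : ℝ) / l - 1) * (BkOf d (l + 1) + VkOf d (l + 1)) <
        (n : ℝ) - (σ : ℝ)) :
    ∃ δ, 0 < δ ∧ ∀ (P : ℝ) (q : ℕ) (α : ℝ), 2 ≤ P → P ^ γi ≤ etaOf d q →
      P ^ (-di) ≤ nint (q * α) → nint (q * α) ≤ P ^ (-(xiOf d)) →
      nint (q * α) ^ (1 / (BkOf d k + VkOf d k)) < MSof d P q α →
      MSof d P q α ^ ((n : ℝ) - σ) ≤
        etaOf d q ^ (-AdOf d) * P ^ (-(d : ℝ) - δ) * (nint (q * α))⁻¹ := by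
  obtain ⟨δ, hδ, hS⟩ := (Finset.Icc k d).exists_pos_forall_of_forall_exists_pos
    (p := SavingAt d n σ di γi) (fun _ _ _ _ h => SavingAt.mono h) fun l hl => by
      rw [Finset.mem_Icc] at hl
      exact exists_savingAt hd hΔ hi (hk.trans hl.1) hl.2 (hcond l hl.1 hl.2)
  refine ⟨δ, hδ, fun P q α hP hη ht ht' hM => ?_⟩
  have hP₀ : 0 < P := by linarith
  have ht₀ : 0 < nint (q * α) := (Real.rpow_pos_of_pos hP₀ _).trans_le ht
  obtain ⟨l, hl, hb, ha⟩ := exists_le_and_le_succ_of_lt hkd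
    (fun l hkl hld => MSof_le_WSof (hk.trans hkl) hld P q α) hM
  rw [if_neg ht₀.ne', le_min_iff] at hb
  exact hS l hl P _ _ _ hP ((Real.rpow_nonneg (nint_nonneg _) _).trans_lt hM) hη ht ht' hb.1 hb.2 ha

/-- `M*(α, q)` where it exceeds `‖qα‖^{1/(B_k + V_k)}`, and `0` elsewhere. -/
def excess (d k : ℕ) (P : ℝ) (q : ℕ) (α : ℝ) : ℝ :=
  if MSof d P q α ≤ nint (q * α) ^ (1 / (BkOf d k + VkOf d k)) then 0 else MSof d P q α

lemma excess_nonneg (d k : ℕ) (P : ℝ) (q : ℕ) (α : ℝ) : 0 ≤ excess d k P q α := by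
  unfold excess
  split_ifs
  · exact le_rfl
  · exact MSof_nonneg ..

lemma MSof_le_excess_add (d k : ℕ) (P : ℝ) (q : ℕ) (α : ℝ) :
    MSof d P q α ≤ excess d k P q α + nint (q * α) ^ (1 / (BkOf d k + VkOf d k)) := by
  unfold excess
  split_ifs with h
  · rwa [zero_add]
  · exact le_add_of_nonneg_right (Real.rpow_nonneg (nint_nonneg _) _)

lemma setIntegral_nint_le {F : ℝ → ℝ} (hF : ∀ α, 0 ≤ F α) {q : ℕ} (hq : 0 < q) {c ε a b : ℝ}
    (hε : 0 < ε) (hc : 0 ≤ c)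
    (h : ∀ α, a ≤ nint (q * α) → nint (q * α) ≤ b → F α ≤ c * nint (q * α) ^ (ε - 1)) :
    ∫ α in {α : ℝ | α ∈ Set.Ico (0 : ℝ) 1 ∧ a ≤ nint (q * α) ∧ nint (q * α) ≤ b}, F α ≤
      c * (2 / ε) := by
  have hs : -1 < ε - 1 := by linarith
  have hint : IntegrableOn (fun α => c * fractMajorant (ε - 1) (q * α)) (Set.Ico 0 1) :=
    (integrableOn_fractMajorant_mul hs hq).const_mul c
  have hsub : {α : ℝ | α ∈ Set.Ico (0 : ℝ) 1 ∧ a ≤ nint (q * α) ∧ nint (q * α) ≤ b} ⊆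
      Set.Ico 0 1 := fun α hα => hα.1
  have hmeas : MeasurableSet
      {α : ℝ | α ∈ Set.Ico (0 : ℝ) 1 ∧ a ≤ nint (q * α) ∧ nint (q * α) ≤ b} := by
    have hn : Measurable fun α : ℝ => nint (q * α) := by
      simp only [nint, abs_sub_round_eq_min]
      fun_prop
    exact measurableSet_Ico.inter
      ((measurableSet_le measurable_const hn).inter (measurableSet_le hn measurable_const))
  calc _ ≤ ∫ α in {α : ℝ | α ∈ Set.Ico (0 : ℝ) 1 ∧ a ≤ nint (q * α) ∧ nint (q * α) ≤ b},
        c * fractMajorant (ε - 1) (q * α) := by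
        refine integral_mono_of_nonneg (Filter.Eventually.of_forall hF) (hint.mono_set hsub) ?_
        refine (ae_restrict_iff' hmeas).2 (Filter.Eventually.of_forall fun α hα => ?_)
        exact (h α hα.2.1 hα.2.2).trans
          (mul_le_mul_of_nonneg_left (nint_rpow_le_fractMajorant _ _) hc)
    _ ≤ ∫ α in Set.Ico (0 : ℝ) 1, c * fractMajorant (ε - 1) (q * α) :=
        setIntegral_mono_set hint
          (Filter.Eventually.of_forall fun α => mul_nonneg hc (fractMajorant_nonneg _ _))
          hsub.eventuallyLE
    _ = c * (2 / ε) := by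
        rw [integral_const_mul, setIntegral_fractMajorant_mul hs hq, sub_add_cancel]

/-- Lemma `inductive argument lemma`. -/
theorem inductive_argument (d k n σ : ℕ) (hd : 3 ≤ d) (hk : 3 ≤ k) (hkd : k ≤ d)
    (hσ : σ < n) (Δ : ℝ) (hΔ : 0 < Δ) (hΔ' : Δ < (d : ℝ) / 3)
    (di γi : ℝ)
    (hi : (di = (d : ℝ) + 2 ∧ γi = Δ / (5 * (2:ℝ) ^ ((d : ℝ) - 2) - 4)) ∨
      (di = (d : ℝ) - Δ ∧ γi = 0))
    (hcond : ∀ l : ℕ, k ≤ l → l ≤ d →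
      AdOf d + (d : ℝ) / l * BkOf d l + ((d : ℝ) / l - 1) * (BkOf d (l + 1) + VkOf d (l + 1)) <
        (n : ℝ) - (σ : ℝ)) :
    ∃ δ : ℝ, 0 < δ ∧
      ∃ E : ℝ → ℕ → ℝ → ℝ, (∀ P q α, 0 ≤ E P q α) ∧
        ∃ K : ℝ, 0 < K ∧
          (∀ P : ℝ, 2 ≤ P → ∀ q : ℕ, 0 < q → ∀ α : ℝ,
            MSof d P q α ≤ K * (E P q α + nint (q * α) ^ (1 / (BkOf d k + VkOf d k)))) ∧
          ∀ P : ℝ, 2 ≤ P →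
            (∑' q : ℕ,
                if 0 < q ∧ P ^ γi ≤ etaOf d q ∧ etaOf d q ≤ P ^ gamOf d then
                  ∫ α in {α : ℝ | α ∈ Set.Ico (0 : ℝ) 1 ∧
                      P ^ (-di) ≤ nint (q * α) ∧ nint (q * α) ≤ P ^ (-(xiOf d))},
                    (E P q α) ^ ((n : ℝ) - σ)
                else 0) ≤ K * P ^ (-(d : ℝ) - δ) := by
  have hd' : (3 : ℝ) ≤ d := by exact_mod_cast hd
  have hs : (n : ℝ) - σ ≠ 0 := by
    have : (σ : ℝ) < n := by exact_mod_cast hσ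
    linarith
  have hdi : 0 < di := by
    rcases hi with ⟨rfl, _⟩ | ⟨rfl, _⟩ <;> linarith
  obtain ⟨δ₀, hδ₀, hpt⟩ := exists_MSof_rpow_le hd hk hkd hΔ hi hcond
  obtain ⟨ε, hε⟩ : ∃ ε, ε = δ₀ / (2 * di) := ⟨_, rfl⟩
  have hε₀ : 0 < ε := by rw [hε]; positivity
  have hεdi : di * ε = δ₀ / 2 := by rw [hε]; field_simp
  have hW : 0 ≤ ∑' q, etaWeight q := tsum_nonneg etaWeight_nonneg
  refine ⟨δ₀ / 2, by positivity, excess d k, excess_nonneg d k,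
    1 + 2 / ε * ∑' q, etaWeight q, by positivity, fun P _ q _ α => ?_, fun P hP => ?_⟩
  · exact (MSof_le_excess_add d k P q α).trans (le_mul_of_one_le_left
      (add_nonneg (excess_nonneg ..) (Real.rpow_nonneg (nint_nonneg _) _))
      (le_add_of_nonneg_right (by positivity)))
  have hP₀ : 0 < P := by linarith
  obtain ⟨R, hR⟩ : ∃ R, R = P ^ (-(d : ℝ) - δ₀ / 2) := ⟨_, rfl⟩
  have hR₀ : 0 ≤ R := by rw [hR]; positivity
  have hpt' : ∀ q : ℕ, P ^ γi ≤ etaOf d q → ∀ α, P ^ (-di) ≤ nint (q * α) →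
      nint (q * α) ≤ P ^ (-(xiOf d)) →
      excess d k P q α ^ ((n : ℝ) - σ) ≤ etaWeight q * R * nint (q * α) ^ (ε - 1) := by
    intro q hη α ht ht'
    have ht₀ : 0 < nint (q * α) := (Real.rpow_pos_of_pos hP₀ _).trans_le ht
    unfold excess
    split_ifs with h
    · rw [Real.zero_rpow hs]
      have := etaWeight_nonneg q
      positivity
    · have hinv : (nint (q * α))⁻¹ ≤ P ^ (δ₀ / 2) * nint (q * α) ^ (ε - 1) := by
        have h₁ : 1 ≤ P ^ (δ₀ / 2) * nint (q * α) ^ ε := by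
          calc (1 : ℝ) = P ^ (δ₀ / 2) * (P ^ (-di)) ^ ε := by
                rw [← Real.rpow_mul hP₀.le, neg_mul, hεdi, ← Real.rpow_add hP₀, add_neg_cancel,
                  Real.rpow_zero]
            _ ≤ _ := by gcongr
        rw [Real.rpow_sub_one ht₀.ne', ← mul_div_assoc, ← one_div]
        gcongr
      calc _ ≤ etaOf d q ^ (-AdOf d) * P ^ (-(d : ℝ) - δ₀) * (nint (q * α))⁻¹ :=
            hpt P q α hP hη ht ht' (not_le.1 h)
        _ ≤ etaWeight q * P ^ (-(d : ℝ) - δ₀) * (P ^ (δ₀ / 2) * nint (q * α) ^ (ε - 1)) := by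
            have := etaWeight_nonneg q
            gcongr
            exact etaOf_rpow_le hd
        _ = etaWeight q * (P ^ (-(d : ℝ) - δ₀) * P ^ (δ₀ / 2)) * nint (q * α) ^ (ε - 1) := by ring
        _ = _ := by
            rw [← Real.rpow_add hP₀, hR]
            ring_nf
  rw [← hR]
  have hterm : ∀ q : ℕ, (if 0 < q ∧ P ^ γi ≤ etaOf d q ∧ etaOf d q ≤ P ^ gamOf d then
      ∫ α in {α : ℝ | α ∈ Set.Ico (0 : ℝ) 1 ∧ P ^ (-di) ≤ nint (q * α) ∧
        nint (q * α) ≤ P ^ (-(xiOf d))}, excess d k P q α ^ ((n : ℝ) - σ)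
      else 0) ≤ etaWeight q * (R * (2 / ε)) := by
    intro q
    have := etaWeight_nonneg q
    split_ifs with h
    · rw [← mul_assoc]
      exact setIntegral_nint_le (fun α => Real.rpow_nonneg (excess_nonneg ..) _) h.1 hε₀
        (by positivity) (hpt' q h.2.1)
    · positivity
  have hsum : Summable fun q => etaWeight q * (R * (2 / ε)) := summable_etaWeight.mul_right _
  calc _ ≤ ∑' q, etaWeight q * (R * (2 / ε)) := by
        refine Summable.tsum_le_tsum hterm (hsum.of_nonneg_of_le (fun q => ?_) hterm) hsum
        split_ifs
        · exact integral_nonneg fun α => Real.rpow_nonneg (excess_nonneg ..) _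
        · exact le_rfl
    _ = 2 / ε * (∑' q, etaWeight q) * R := by
        rw [tsum_mul_right]
        ring
    _ ≤ _ := by
        gcongr
        linarith

end
end
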